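/- Let k ≥ 2 and let (T_m) be a sequence of k-regular trees with edge length functions such that |I_m| → ∞ and IPL(T_m)/|I_m|² → 0 as m → ∞, where I_m is the interior node set of T_m. Let ζ_m be the fraction of vanishing entries of Φ_m' C_m Φ_m, where C_m is the covariance matrix and Φ_m the Haar-like matrix of T_m. Then ζ_m → 1 as m → ∞. -/

import Mathlib

/-- A finite rooted tree, encoded by a parent function together with a depth
function certifying acyclicity and connectivity to the root. -/
structure FinRootedTree where
  V : Type
  fintypeV : Fintype V
  decEqV : DecidableEq V
  root : V
  parent : V → V
  parent_root : parent root = root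
  depth : V → ℕ
  depth_eq_zero : ∀ v : V, depth v = 0 ↔ v = root
  depth_parent : ∀ v : V, v ≠ root → depth (parent v) + 1 = depth v

attribute [instance] FinRootedTree.fintypeV FinRootedTree.decEqV

namespace FinRootedTree

variable (T : FinRootedTree)

/-- The children of a vertex. -/
def children (v : T.V) : Finset T.V :=
  Finset.univ.filter fun u => u ≠ T.root ∧ T.parent u = v

/-- A vertex is a leaf when it has no children. -/
def IsLeaf (v : T.V) : Prop := T.children v = ∅

instance : DecidablePred T.IsLeaf := fun v =>
  decidable_of_iff (T.children v = ∅) Iff.rfl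

/-- The set of leaves. -/
def leaves : Finset T.V := Finset.univ.filter fun v => T.IsLeaf v

/-- The set of interior nodes. -/
def interior : Finset T.V := Finset.univ.filter fun v => ¬ T.IsLeaf v

/-- The ancestors of `v`, including `v` itself. -/
def ancSelf (v : T.V) : Finset T.V :=
  (Finset.range (Fintype.card T.V + 1)).image (fun m => T.parent^[m] v)

/-- The edges on the path from `v` to the root; each edge is identified with
its endpoint farther from the root. -/
def edgesToRoot (v : T.V) : Finset T.V := (T.ancSelf v).erase T.root

/-- The edges on the path between `u` and `v`. -/
def pathEdges (u v : T.V) : Finset T.V :=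
  (T.edgesToRoot u \ T.edgesToRoot v) ∪ (T.edgesToRoot v \ T.edgesToRoot u)

/-- The leaves of the subtree rooted at `v`. -/
def leavesBelow (v : T.V) : Finset T.V := T.leaves.filter fun i => v ∈ T.ancSelf i

/-- The phylogenetic covariance matrix: `cov ℓ i j = ∑_{e ∈ [i∧j, ∘]} ℓ(e)`
(the edges from the least common ancestor of `i` and `j` to the root are
exactly the common ancestors of `i` and `j` other than the root). -/
def cov (ℓ : T.V → ℝ) (i j : T.V) : ℝ :=
  ∑ w ∈ T.edgesToRoot i ∩ T.edgesToRoot j, ℓ w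

/-- The trace length `ℓ*(u,v) = ∑_{e ∈ [u,v]} |L(e)| ℓ(e)`. -/
def traceLength (ℓ : T.V → ℝ) (u v : T.V) : ℝ :=
  ∑ w ∈ T.pathEdges u v, ((T.leavesBelow w).card : ℝ) * ℓ w

/-- Internal path length: the sum of the depths of the interior nodes. -/
def IPL : ℕ := ∑ v ∈ T.interior, T.depth v

/-- `T` is `k`-regular: the root has exactly one child and every other
interior node has exactly `k` children. -/
def IsKRegular (k : ℕ) : Prop :=
  (T.children T.root).card = 1 ∧
    ∀ v : T.V, v ≠ T.root → ¬ T.IsLeaf v → (T.children v).card = k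

end FinRootedTree

/-- A `k`-regular structure on a finite rooted tree: an ordering of the
children of each interior non-root node by `{0, …, k-1}` (index `i`
corresponds to the child `v_{i+1}` of the paper), the root having degree
one. -/
structure KRegStruct (k : ℕ) (T : FinRootedTree) where
  child : T.V → ℕ → T.V
  root_deg : (T.children T.root).card = 1
  child_mem : ∀ v : T.V, v ≠ T.root → ¬ T.IsLeaf v → ∀ i < k, child v i ∈ T.children v
  child_inj : ∀ v : T.V, v ≠ T.root → ¬ T.IsLeaf v →
      ∀ i < k, ∀ j < k, child v i = child v j → i = j
  child_surj : ∀ v : T.V, v ≠ T.root → ¬ T.IsLeaf v →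
      ∀ u ∈ T.children v, ∃ i < k, child v i = u

/-- The mother wavelet `φ_∘` of a tree. -/
noncomputable def FinRootedTree.rootWavelet (T : FinRootedTree) : T.V → ℝ :=
  fun _ => 1 / Real.sqrt ((T.leaves.card : ℝ))

/-- The index set of the Haar-like wavelets: the root index `none` together
with the pairs `(v, n)` for `v` an interior non-root node and `1 ≤ n < k`. -/
def FinRootedTree.waveletIdx (k : ℕ) (T : FinRootedTree) : Finset (Option (T.V × ℕ)) :=
  insert none (((T.interior.erase T.root) ×ˢ Finset.Ico 1 k).image some)

namespace KRegStruct

variable {k : ℕ} {T : FinRootedTree} (R : KRegStruct k T)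

/-- `L_{v,n}`: the leaves below the first `n` children of `v`. -/
def Lpart (v : T.V) (n : ℕ) : Finset T.V :=
  (Finset.range n).biUnion fun j => T.leavesBelow (R.child v j)

/-- `L(v_{n+1})`: the leaves below the `(n+1)`-st child of `v`. -/
def Lnext (v : T.V) (n : ℕ) : Finset T.V := T.leavesBelow (R.child v n)

/-- The Haar-like wavelet `φ_{v,n}`. -/
noncomputable def wavelet (v : T.V) (n : ℕ) : T.V → ℝ := fun i =>
  if i ∈ R.Lpart v n then
    Real.sqrt (((R.Lnext v n).card : ℝ) /
      (((R.Lpart v n).card : ℝ) * (((R.Lpart v n ∪ R.Lnext v n)).card : ℝ)))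
  else if i ∈ R.Lnext v n then
    - Real.sqrt (((R.Lpart v n).card : ℝ) /
      (((R.Lnext v n).card : ℝ) * (((R.Lpart v n ∪ R.Lnext v n)).card : ℝ)))
  else 0

/-- `ψ` is a Haar-like wavelet associated with the node `v`. -/
def IsWaveletAt (v : T.V) (ψ : T.V → ℝ) : Prop :=
  (v = T.root ∧ ψ = T.rootWavelet) ∨
    (v ≠ T.root ∧ ∃ n : ℕ, 1 ≤ n ∧ n < k ∧ ψ = R.wavelet v n)

/-- The family of all Haar-like wavelets, as indexed above (the columns of the
Haar-like matrix `Φ`). -/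
noncomputable def waveFun : Option (T.V × ℕ) → T.V → ℝ
  | none => T.rootWavelet
  | some (v, n) => R.wavelet v n

/-- The entry of `Φ' C Φ` in row `a` and column `b`. -/
noncomputable def entry (ℓ : T.V → ℝ) (a b : Option (T.V × ℕ)) : ℝ :=
  ∑ j ∈ T.leaves, ∑ i ∈ T.leaves, R.waveFun a j * T.cov ℓ j i * R.waveFun b i

open Classical in
/-- `ζ`: the fraction of vanishing entries of the `|L| × |L|` matrix `Φ' C Φ`. -/
noncomputable def zeta (ℓ : T.V → ℝ) : ℝ :=
  ((((T.waveletIdx k ×ˢ T.waveletIdx k).filter fun p => R.entry ℓ p.1 p.2 = 0).card : ℝ)) /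
    ((T.leaves.card : ℝ)) ^ 2

end KRegStruct

namespace FinRootedTree

variable (T : FinRootedTree)

lemma depth_parent' (v : T.V) : T.depth (T.parent v) = T.depth v - 1 := by
  by_cases h : v = T.root
  · subst h
    rw [T.parent_root, (T.depth_eq_zero _).2 rfl]
  · have := T.depth_parent v h
    omega

lemma depth_iter (m : ℕ) (v : T.V) : T.depth (T.parent^[m] v) = T.depth v - m := by
  induction m with
  | zero => simp
  | succ m ih => rw [Function.iterate_succ_apply', depth_parent', ih]; omega

lemma depth_le_card (v : T.V) : T.depth v ≤ Fintype.card T.V := by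
  have h : Set.InjOn (fun m => T.parent^[m] v) (Finset.range (T.depth v + 1) : Finset ℕ) := by
    intro a ha b hb hab
    simp only [Finset.coe_range, Set.mem_Iio] at ha hb
    have := congrArg T.depth hab
    simp only [depth_iter] at this
    omega
  have h2 := Finset.card_image_of_injOn h
  have h3 := Finset.card_le_univ ((Finset.range (T.depth v + 1)).image (fun m => T.parent^[m] v))
  rw [h2, Finset.card_range] at h3
  omega

lemma mem_anc {w v : T.V} : w ∈ T.ancSelf v ↔
    T.depth w ≤ T.depth v ∧ T.parent^[T.depth v - T.depth w] v = w := by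
  unfold ancSelf
  simp only [Finset.mem_image, Finset.mem_range]
  constructor
  · rintro ⟨m, -, rfl⟩
    rw [depth_iter]
    refine ⟨by omega, ?_⟩
    by_cases h : m ≤ T.depth v
    · congr 2; omega
    · have e : T.depth v - (T.depth v - m) = T.depth v := by omega
      rw [e]
      have h1 : T.parent^[m] v = T.root := (T.depth_eq_zero _).1 (by rw [depth_iter]; omega)
      have h2 : T.parent^[T.depth v] v = T.root :=
        (T.depth_eq_zero _).1 (by rw [depth_iter]; omega)
      rw [h1, h2]
  · rintro ⟨_, h⟩
    exact ⟨_, by have := T.depth_le_card v; omega, h⟩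

lemma mem_anc_of_iter {w v : T.V} (m : ℕ) (h : T.parent^[m] v = w) : w ∈ T.ancSelf v := by
  rw [mem_anc]
  subst h
  have := T.mem_anc (w := T.parent^[m] v) (v := v)
  rw [depth_iter]
  refine ⟨by omega, ?_⟩
  by_cases h : m ≤ T.depth v
  · congr 2; omega
  · have e : T.depth v - (T.depth v - m) = T.depth v := by omega
    rw [e]
    have h1 : T.parent^[m] v = T.root := (T.depth_eq_zero _).1 (by rw [depth_iter]; omega)
    have h2 : T.parent^[T.depth v] v = T.root :=
      (T.depth_eq_zero _).1 (by rw [depth_iter]; omega)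
    rw [h1, h2]

lemma anc_trans {u v w : T.V} (h1 : u ∈ T.ancSelf v) (h2 : v ∈ T.ancSelf w) :
    u ∈ T.ancSelf w := by
  obtain ⟨-, h1⟩ := T.mem_anc.1 h1
  obtain ⟨-, h2⟩ := T.mem_anc.1 h2
  refine T.mem_anc_of_iter ((T.depth v - T.depth u) + (T.depth w - T.depth v)) ?_
  rw [Function.iterate_add_apply, h2, h1]

lemma root_anc (v : T.V) : T.root ∈ T.ancSelf v :=
  T.mem_anc_of_iter (T.depth v) ((T.depth_eq_zero _).1 (by rw [depth_iter]; omega))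

lemma anc_total {u v w : T.V} (h1 : u ∈ T.ancSelf w) (h2 : v ∈ T.ancSelf w) :
    u ∈ T.ancSelf v ∨ v ∈ T.ancSelf u := by
  obtain ⟨a1, h1⟩ := T.mem_anc.1 h1
  obtain ⟨a2, h2⟩ := T.mem_anc.1 h2
  rcases le_total (T.depth u) (T.depth v) with h | h
  · left
    refine T.mem_anc_of_iter (T.depth v - T.depth u) ?_
    have e : T.depth w - T.depth u =
        (T.depth v - T.depth u) + (T.depth w - T.depth v) := by omega
    rw [e, Function.iterate_add_apply, h2] at h1
    exact h1
  · right
    refine T.mem_anc_of_iter (T.depth u - T.depth v) ?_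
    have e : T.depth w - T.depth v =
        (T.depth u - T.depth v) + (T.depth w - T.depth u) := by omega
    rw [e, Function.iterate_add_apply, h1] at h2
    exact h2

lemma anc_eq {u v w : T.V} (h1 : u ∈ T.ancSelf w) (h2 : v ∈ T.ancSelf w)
    (h : T.depth u = T.depth v) : u = v := by
  obtain ⟨a1, h1⟩ := T.mem_anc.1 h1
  obtain ⟨a2, h2⟩ := T.mem_anc.1 h2
  rw [← h1, ← h2, h]

lemma card_edges (v : T.V) : (T.edgesToRoot v).card ≤ T.depth v := by
  have h : T.ancSelf v ⊆ (Finset.range (T.depth v + 1)).image (fun m => T.parent^[m] v) := by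
    intro w hw
    obtain ⟨_, h⟩ := T.mem_anc.1 hw
    exact Finset.mem_image.2 ⟨_, Finset.mem_range.2 (by omega), h⟩
  have h2 := (Finset.card_le_card h).trans Finset.card_image_le
  rw [Finset.card_range] at h2
  unfold edgesToRoot
  rw [Finset.card_erase_of_mem (T.root_anc v)]
  omega

lemma mem_children {u v : T.V} : u ∈ T.children v ↔ u ≠ T.root ∧ T.parent u = v := by
  simp [children]

lemma child_depth {u v : T.V} (h : u ∈ T.children v) : T.depth u = T.depth v + 1 := by
  obtain ⟨h1, rfl⟩ := T.mem_children.1 h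
  exact (T.depth_parent u h1).symm

lemma child_anc {u v : T.V} (h : u ∈ T.children v) : v ∈ T.ancSelf u :=
  T.mem_anc_of_iter 1 (T.mem_children.1 h).2

lemma mem_below {i v : T.V} : i ∈ T.leavesBelow v ↔ i ∈ T.leaves ∧ v ∈ T.ancSelf i := by
  simp [leavesBelow]

lemma sum_children : ∑ v : T.V, (T.children v).card + 1 = Fintype.card T.V := by
  have h := Finset.card_eq_sum_card_fiberwise (f := T.parent)
    (s := Finset.univ.erase T.root) (t := Finset.univ) (by intro x _; simp)
  have h2 : ∀ v, (T.children v).card =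
      ((Finset.univ.erase T.root).filter (fun a => T.parent a = v)).card := by
    intro v
    congr 1
    ext u
    simp [children]
  simp only [h2]
  rw [← h]
  exact Finset.card_erase_add_one (Finset.mem_univ _)

lemma leaves_add_interior : T.leaves.card + T.interior.card = Fintype.card T.V :=
  Finset.card_filter_add_card_filter_not (s := Finset.univ) (fun v => T.IsLeaf v)

end FinRootedTree

namespace KRegStruct

variable {k : ℕ} {T : FinRootedTree} (R : KRegStruct k T)

lemma card_children (R : KRegStruct k T) {v : T.V} (h : v ≠ T.root) (hl : ¬ T.IsLeaf v) :
    (T.children v).card = k := by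
  have : T.children v = (Finset.range k).image (R.child v) := by
    ext u
    simp only [Finset.mem_image, Finset.mem_range]
    constructor
    · exact R.child_surj v h hl u
    · rintro ⟨i, hi, rfl⟩
      exact R.child_mem v h hl i hi
  rw [this, Finset.card_image_of_injOn, Finset.card_range]
  intro i hi j hj hij
  simp only [Finset.coe_range, Set.mem_Iio] at hi hj
  exact R.child_inj v h hl i hi j hj hij

lemma root_interior (R : KRegStruct k T) : T.root ∈ T.interior := by
  have := R.root_deg
  simp only [FinRootedTree.interior, Finset.mem_filter, Finset.mem_univ, true_and]
  intro h
  unfold FinRootedTree.IsLeaf at h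
  rw [h] at this
  simp at this

lemma card_eq (R : KRegStruct k T) : T.leaves.card + T.interior.card = 2 + (T.interior.card - 1) * k := by
  rw [T.leaves_add_interior, ← T.sum_children]
  have h1 : ∑ v : T.V, (T.children v).card = ∑ v ∈ T.interior, (T.children v).card := by
    symm
    apply Finset.sum_subset (Finset.subset_univ _)
    intro x _ hx
    simp only [FinRootedTree.interior, Finset.mem_filter, Finset.mem_univ, true_and,
      not_not] at hx
    rw [hx]; rfl
  rw [h1, ← Finset.add_sum_erase _ _ R.root_interior, R.root_deg]
  have h2 : ∑ v ∈ T.interior.erase T.root, (T.children v).card =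
      ∑ v ∈ T.interior.erase T.root, k := by
    apply Finset.sum_congr rfl
    intro v hv
    simp only [FinRootedTree.interior, Finset.mem_erase, Finset.mem_filter, Finset.mem_univ,
      true_and] at hv
    exact R.card_children hv.1 hv.2
  rw [h2, Finset.sum_const, Finset.card_erase_of_mem R.root_interior, smul_eq_mul]
  omega

lemma card_idx (R : KRegStruct k T) (hk : 2 ≤ k) : (T.waveletIdx k).card = T.leaves.card := by
  unfold FinRootedTree.waveletIdx
  rw [Finset.card_insert_of_notMem (by simp),
    Finset.card_image_of_injective _ (Option.some_injective _), Finset.card_product,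
    Finset.card_erase_of_mem R.root_interior, Nat.card_Ico]
  have h := R.card_eq
  have h2 : 0 < T.interior.card := Finset.card_pos.2 ⟨_, R.root_interior⟩
  obtain ⟨j, rfl⟩ : ∃ j, k = j + 1 := ⟨k - 1, by omega⟩
  obtain ⟨n, hn⟩ : ∃ n, T.interior.card = n + 1 := ⟨T.interior.card - 1, by omega⟩
  rw [hn] at h ⊢
  simp only [Nat.add_sub_cancel] at h ⊢
  nlinarith

lemma interior_le (R : KRegStruct k T) (hk : 2 ≤ k) : T.interior.card ≤ T.leaves.card := by
  have h := R.card_eq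
  have h2 : 0 < T.interior.card := Finset.card_pos.2 ⟨_, R.root_interior⟩
  obtain ⟨n, hn⟩ : ∃ n, T.interior.card = n + 1 := ⟨T.interior.card - 1, by omega⟩
  rw [hn] at h ⊢
  simp only [Nat.add_sub_cancel] at h
  nlinarith

lemma disj {v : T.V} {n : ℕ} (h : v ≠ T.root) (hl : ¬ T.IsLeaf v) (hn : n < k) :
    Disjoint (R.Lpart v n) (R.Lnext v n) := by
  rw [Finset.disjoint_left]
  intro i hi hi2
  simp only [Lpart, Finset.mem_biUnion, Finset.mem_range] at hi
  obtain ⟨j, hj, hi⟩ := hi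
  have hc1 := R.child_mem v h hl j (hj.trans hn)
  have hc2 := R.child_mem v h hl n hn
  have e := T.anc_eq (T.mem_below.1 hi).2 (T.mem_below.1 hi2).2
    (by rw [T.child_depth hc1, T.child_depth hc2])
  have := R.child_inj v h hl j (hj.trans hn) n hn e
  omega

lemma part_anc {v i : T.V} {n : ℕ} (h : v ≠ T.root) (hl : ¬ T.IsLeaf v) (hn : n < k)
    (hi : i ∈ R.Lpart v n ∪ R.Lnext v n) : i ∈ T.leaves ∧ v ∈ T.ancSelf i := by
  rw [Finset.mem_union] at hi
  rcases hi with hi | hi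
  · simp only [Lpart, Finset.mem_biUnion, Finset.mem_range] at hi
    obtain ⟨j, hj, hi⟩ := hi
    have hc1 := R.child_mem v h hl j (hj.trans hn)
    have := T.mem_below.1 hi
    exact ⟨this.1, T.anc_trans (T.child_anc hc1) this.2⟩
  · have hc1 := R.child_mem v h hl n hn
    have := T.mem_below.1 hi
    exact ⟨this.1, T.anc_trans (T.child_anc hc1) this.2⟩

lemma sqrt_aux (p n q : ℝ) (hp : 0 ≤ p) (hn : 0 ≤ n) :
    p * Real.sqrt (n / (p * q)) = n * Real.sqrt (p / (n * q)) := by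
  rcases hp.eq_or_lt with rfl | hp
  · simp
  rcases hn.eq_or_lt with rfl | hn
  · simp
  have e1 : p * Real.sqrt (n / (p * q)) = Real.sqrt (p ^ 2 * (n / (p * q))) := by
    rw [Real.sqrt_mul (by positivity), Real.sqrt_sq hp.le]
  have e2 : n * Real.sqrt (p / (n * q)) = Real.sqrt (n ^ 2 * (p / (n * q))) := by
    rw [Real.sqrt_mul (by positivity), Real.sqrt_sq hn.le]
  rw [e1, e2]
  congr 1
  rcases eq_or_ne q 0 with rfl | hq
  · simp
  field_simp

lemma wavelet_zero {v i : T.V} {n : ℕ} (hi : i ∉ R.Lpart v n ∪ R.Lnext v n) :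
    R.wavelet v n i = 0 := by
  rw [Finset.mem_union, not_or] at hi
  simp [wavelet, hi.1, hi.2]

lemma wavelet_sum {v : T.V} {n : ℕ} (h : v ≠ T.root) (hl : ¬ T.IsLeaf v) (hn : n < k) :
    ∑ i ∈ R.Lpart v n ∪ R.Lnext v n, R.wavelet v n i = 0 := by
  have hd := R.disj h hl hn
  rw [Finset.sum_union hd]
  have h1 : ∀ i ∈ R.Lpart v n, R.wavelet v n i = Real.sqrt (((R.Lnext v n).card : ℝ) /
      (((R.Lpart v n).card : ℝ) * (((R.Lpart v n ∪ R.Lnext v n)).card : ℝ))) := by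
    intro i hi
    simp only [wavelet, if_pos hi]
  have h2 : ∀ i ∈ R.Lnext v n, R.wavelet v n i = -Real.sqrt (((R.Lpart v n).card : ℝ) /
      (((R.Lnext v n).card : ℝ) * (((R.Lpart v n ∪ R.Lnext v n)).card : ℝ))) := by
    intro i hi
    have hi' : i ∉ R.Lpart v n := fun hh => Finset.disjoint_left.1 hd hh hi
    simp only [wavelet, if_neg hi', if_pos hi]
  rw [Finset.sum_congr rfl h1, Finset.sum_congr rfl h2, Finset.sum_const, Finset.sum_const,
    nsmul_eq_mul, nsmul_eq_mul, sqrt_aux _ _ _ (by positivity) (by positivity)]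
  ring

/-- The node of a wavelet index. -/
def nodeOf (T : FinRootedTree) : Option (T.V × ℕ) → T.V
  | none => T.root
  | some p => p.1

/-- The sum of a wavelet over the leaves below `w`. -/
noncomputable def subSum (a : Option (T.V × ℕ)) (w : T.V) : ℝ :=
  ∑ i ∈ T.leaves, if w ∈ T.ancSelf i then R.waveFun a i else 0

lemma subSum_zero {a : Option (T.V × ℕ)} (ha : a ∈ T.waveletIdx k) {w : T.V}
    (hw : nodeOf T a ∉ T.ancSelf w) : R.subSum a w = 0 := by
  rcases a with _ | ⟨v, n⟩
  · exact absurd (T.root_anc w) hw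
  simp only [FinRootedTree.waveletIdx, Finset.mem_insert, reduceCtorEq, Finset.mem_image,
    Finset.mem_product, Finset.mem_erase, FinRootedTree.interior, Finset.mem_filter,
    Finset.mem_univ, true_and, Finset.mem_Ico, Option.some.injEq, exists_eq_right, false_or] at ha
  obtain ⟨⟨h, hl⟩, h1, hn⟩ := ha
  simp only [nodeOf] at hw
  unfold subSum
  simp only [waveFun]
  by_cases hwv : w ∈ T.ancSelf v
  · refine Eq.trans ?_ (R.wavelet_sum h hl hn)
    have hs : R.Lpart v n ∪ R.Lnext v n ⊆ T.leaves := fun i hi => (R.part_anc h hl hn hi).1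
    rw [← Finset.sum_subset hs]
    · apply Finset.sum_congr rfl
      intro i hi
      rw [if_pos (T.anc_trans hwv (R.part_anc h hl hn hi).2)]
    · intro i _ hi
      rw [R.wavelet_zero hi, ite_self]
  · apply Finset.sum_eq_zero
    intro i hi
    split_ifs with hwi
    · apply R.wavelet_zero
      intro hi2
      rcases T.anc_total (R.part_anc h hl hn hi2).2 hwi with h3 | h3
      · exact hw h3
      · exact hwv h3
    · rfl

lemma entry_eq (ℓ : T.V → ℝ) (a b : Option (T.V × ℕ)) :
    R.entry ℓ a b = ∑ w ∈ Finset.univ.erase T.root, ℓ w * (R.subSum a w * R.subSum b w) := by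
  have hc : ∀ i j, T.cov ℓ i j = ∑ w ∈ Finset.univ.erase T.root,
      (if w ∈ T.ancSelf i then 1 else 0) * ℓ w * (if w ∈ T.ancSelf j then 1 else 0) := by
    intro i j
    unfold FinRootedTree.cov
    have hs : T.edgesToRoot i ∩ T.edgesToRoot j ⊆ Finset.univ.erase T.root := by
      intro w hw
      simp only [FinRootedTree.edgesToRoot, Finset.mem_inter, Finset.mem_erase] at hw
      simp [hw.1.1]
    rw [← Finset.sum_subset hs]
    · apply Finset.sum_congr rfl
      intro w hw
      simp only [FinRootedTree.edgesToRoot, Finset.mem_inter, Finset.mem_erase] at hw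
      simp [hw.1.2, hw.2.2]
    · intro w hw hw2
      simp only [FinRootedTree.edgesToRoot, Finset.mem_inter, Finset.mem_erase,
        Finset.mem_univ, and_true] at hw hw2
      by_cases h1 : w ∈ T.ancSelf i
      · by_cases h2 : w ∈ T.ancSelf j
        · exact absurd ⟨⟨hw, h1⟩, hw, h2⟩ hw2
        · simp [h2]
      · simp [h1]
  unfold entry subSum
  simp only [hc, Finset.sum_mul_sum]
  simp only [Finset.mul_sum, Finset.sum_mul]
  have : ∀ j ∈ T.leaves, ∑ i ∈ T.leaves, ∑ w ∈ Finset.univ.erase T.root,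
      R.waveFun a j * ((if w ∈ T.ancSelf j then 1 else 0) * ℓ w *
        (if w ∈ T.ancSelf i then 1 else 0)) * R.waveFun b i =
      ∑ w ∈ Finset.univ.erase T.root, ∑ i ∈ T.leaves,
      R.waveFun a j * ((if w ∈ T.ancSelf j then 1 else 0) * ℓ w *
        (if w ∈ T.ancSelf i then 1 else 0)) * R.waveFun b i :=
    fun j _ => Finset.sum_comm
  rw [Finset.sum_congr rfl this, Finset.sum_comm]
  refine Finset.sum_congr rfl fun w _ => Finset.sum_congr rfl fun j _ =>
    Finset.sum_congr rfl fun i _ => ?_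
  split_ifs <;> ring

lemma entry_zero (ℓ : T.V → ℝ) {a b : Option (T.V × ℕ)} (ha : a ∈ T.waveletIdx k)
    (hb : b ∈ T.waveletIdx k) (h1 : nodeOf T a ∉ T.ancSelf (nodeOf T b))
    (h2 : nodeOf T b ∉ T.ancSelf (nodeOf T a)) : R.entry ℓ a b = 0 := by
  rw [entry_eq]
  apply Finset.sum_eq_zero
  intro w _
  by_cases hwa : nodeOf T a ∈ T.ancSelf w
  · by_cases hwb : nodeOf T b ∈ T.ancSelf w
    · rcases T.anc_total hwa hwb with h | h
      · exact absurd h h1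
      · exact absurd h h2
    · rw [R.subSum_zero hb hwb]; ring
  · rw [R.subSum_zero ha hwa]; ring

/-- The pairs of indices whose nodes are comparable in the given order. -/
def cmpPairs (k : ℕ) (T : FinRootedTree) : Finset (Option (T.V × ℕ) × Option (T.V × ℕ)) :=
  (T.waveletIdx k).biUnion fun b =>
    (((T.waveletIdx k).filter fun a => nodeOf T a ∈ T.ancSelf (nodeOf T b))).image
      fun a => (a, b)

lemma card_cmpPairs : (cmpPairs k T).card ≤
    (T.waveletIdx k).card + (k - 1) ^ 2 * T.IPL := by
  have h1 : ∀ b ∈ T.waveletIdx k,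
      ((((T.waveletIdx k).filter fun a => nodeOf T a ∈ T.ancSelf (nodeOf T b))).image
      fun a => (a, b)).card ≤ 1 + (k - 1) * T.depth (nodeOf T b) := by
    intro b _
    refine Finset.card_image_le.trans ?_
    have hs : ((T.waveletIdx k).filter fun a => nodeOf T a ∈ T.ancSelf (nodeOf T b)) ⊆
        insert none (((T.edgesToRoot (nodeOf T b)) ×ˢ Finset.Ico 1 k).image some) := by
      intro a ha
      rcases a with _ | ⟨v, n⟩
      · simp
      · rw [Finset.mem_filter] at ha
        simp only [FinRootedTree.waveletIdx, Finset.mem_insert, reduceCtorEq,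
          Finset.mem_image, Finset.mem_product, Finset.mem_erase, Finset.mem_Ico,
          Option.some.injEq, exists_eq_right, false_or, nodeOf,
          FinRootedTree.edgesToRoot] at ha ⊢
        exact ⟨⟨ha.1.1.1, ha.2⟩, ha.1.2⟩
    refine (Finset.card_le_card hs).trans ((Finset.card_insert_le _ _).trans ?_)
    have h2 : ((((T.edgesToRoot (nodeOf T b)) ×ˢ Finset.Ico 1 k).image some).card) ≤
        (k - 1) * T.depth (nodeOf T b) := by
      refine Finset.card_image_le.trans ?_
      rw [Finset.card_product, Nat.card_Ico, mul_comm]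
      exact Nat.mul_le_mul_left _ (T.card_edges _)
    omega
  refine Finset.card_biUnion_le.trans ((Finset.sum_le_sum h1).trans ?_)
  rw [Finset.sum_add_distrib, ← Finset.mul_sum]
  simp only [Finset.sum_const, smul_eq_mul, mul_one]
  refine Nat.add_le_add_left ?_ _
  rw [sq, mul_assoc]
  refine Nat.mul_le_mul_left _ ?_
  unfold FinRootedTree.waveletIdx
  rw [Finset.sum_insert (by simp), Finset.sum_image (by intro x _ y _ h; simpa using h),
    Finset.sum_product]
  simp only [nodeOf, Finset.sum_const, Nat.card_Ico, smul_eq_mul]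
  rw [(T.depth_eq_zero _).2 rfl, zero_add, ← Finset.mul_sum]
  refine Nat.mul_le_mul_left _ ?_
  exact Finset.sum_le_sum_of_subset (Finset.erase_subset _ _)

lemma zeta_bounds (hk : 2 ≤ k) (ℓ : T.V → ℝ) :
    R.zeta ℓ ≤ 1 ∧ 1 - (2 * ((T.interior.card : ℝ))⁻¹ +
      2 * ((k - 1 : ℕ) : ℝ) ^ 2 * ((T.IPL : ℝ) / (T.interior.card : ℝ) ^ 2)) ≤ R.zeta ℓ := by
  classical
  have hIpos : 0 < T.interior.card := Finset.card_pos.2 ⟨_, R.root_interior⟩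
  have hIL := R.interior_le hk
  have hW := R.card_idx hk
  have hI' : (0 : ℝ) < T.interior.card := by exact_mod_cast hIpos
  have hIL' : (T.interior.card : ℝ) ≤ T.leaves.card := by exact_mod_cast hIL
  have hL' : (0 : ℝ) < T.leaves.card := hI'.trans_le hIL'
  set Z := (T.waveletIdx k ×ˢ T.waveletIdx k).filter fun p => R.entry ℓ p.1 p.2 = 0 with hZ
  set N := (T.waveletIdx k ×ˢ T.waveletIdx k).filter fun p => ¬ R.entry ℓ p.1 p.2 = 0 with hN
  have hz : R.zeta ℓ = (Z.card : ℝ) / (T.leaves.card : ℝ) ^ 2 := by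
    unfold zeta
    congr!
  have hsum : Z.card + N.card = T.leaves.card ^ 2 := by
    rw [hZ, hN, Finset.card_filter_add_card_filter_not, Finset.card_product, hW, sq]
  have hNle : N.card ≤ 2 * (T.leaves.card + (k - 1) ^ 2 * T.IPL) := by
    have hs : N ⊆ cmpPairs k T ∪ (cmpPairs k T).image Prod.swap := by
      rintro ⟨a, b⟩ hab
      rw [hN, Finset.mem_filter, Finset.mem_product] at hab
      obtain ⟨⟨ha, hb⟩, hne⟩ := hab
      simp only at ha hb hne
      rw [Finset.mem_union]
      by_cases h1 : nodeOf T a ∈ T.ancSelf (nodeOf T b)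
      · left
        exact Finset.mem_biUnion.2 ⟨b, hb, Finset.mem_image.2
          ⟨a, Finset.mem_filter.2 ⟨ha, h1⟩, rfl⟩⟩
      · by_cases h2 : nodeOf T b ∈ T.ancSelf (nodeOf T a)
        · right
          exact Finset.mem_image.2 ⟨(b, a), Finset.mem_biUnion.2 ⟨a, ha, Finset.mem_image.2
            ⟨b, Finset.mem_filter.2 ⟨hb, h2⟩, rfl⟩⟩, rfl⟩
        · exact absurd (R.entry_zero ℓ ha hb h1 h2) hne
    have h1 := (Finset.card_le_card hs).trans (Finset.card_union_le _ _)
    have h2 : ((cmpPairs k T).image Prod.swap).card ≤ (cmpPairs k T).card :=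
      Finset.card_image_le
    have h3 := card_cmpPairs (k := k) (T := T)
    rw [hW] at h3
    omega
  have hsum' : (Z.card : ℝ) + N.card = (T.leaves.card : ℝ) ^ 2 := by exact_mod_cast hsum
  have hNle' : (N.card : ℝ) ≤ 2 * (T.leaves.card + ((k - 1 : ℕ) : ℝ) ^ 2 * T.IPL) := by
    exact_mod_cast hNle
  have hNn : (0 : ℝ) ≤ N.card := by positivity
  rw [hz]
  constructor
  · rw [div_le_one (by positivity)]
    linarith
  · have e : (Z.card : ℝ) / (T.leaves.card : ℝ) ^ 2 =
        1 - (N.card : ℝ) / (T.leaves.card : ℝ) ^ 2 := by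
      rw [eq_sub_iff_add_eq, ← add_div, hsum', div_self (by positivity)]
    rw [e]
    apply sub_le_sub_left
    calc (N.card : ℝ) / (T.leaves.card : ℝ) ^ 2
        ≤ (2 * (T.leaves.card + ((k - 1 : ℕ) : ℝ) ^ 2 * T.IPL)) / (T.leaves.card : ℝ) ^ 2 := by
          gcongr
      _ = 2 * ((T.leaves.card : ℝ))⁻¹ +
          2 * ((k - 1 : ℕ) : ℝ) ^ 2 * ((T.IPL : ℝ) / (T.leaves.card : ℝ) ^ 2) := by
          field_simp
      _ ≤ _ := by gcongr

end KRegStruct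

open Filter in
/-- For a sequence of `k`-regular trees with `|I_m| → ∞` and
`IPL(T_m)/|I_m|² → 0`, the fraction `ζ_m` of vanishing entries of
`Φ_m' C_m Φ_m` tends to `1`. -/
theorem zeta_tendsto_one (k : ℕ) (hk : 2 ≤ k) (T : ℕ → FinRootedTree)
    (R : ∀ m, KRegStruct k (T m)) (ℓ : ∀ m, (T m).V → ℝ)
    (hℓ : ∀ m, ∀ w : (T m).V, w ≠ (T m).root → 0 < ℓ m w)
    (hI : Tendsto (fun m => (T m).interior.card) atTop atTop)
    (hIPL : Tendsto (fun m => ((T m).IPL : ℝ) / ((T m).interior.card : ℝ) ^ 2)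
      atTop (nhds 0)) :
    Tendsto (fun m => (R m).zeta (ℓ m)) atTop (nhds 1) := by
  have hI' : Tendsto (fun m => ((T m).interior.card : ℝ)) atTop atTop :=
    tendsto_natCast_atTop_atTop.comp hI
  have hlim : Tendsto (fun m => 1 - (2 * (((T m).interior.card : ℝ))⁻¹ +
      2 * ((k - 1 : ℕ) : ℝ) ^ 2 * (((T m).IPL : ℝ) / ((T m).interior.card : ℝ) ^ 2)))
      atTop (nhds 1) := by
    have h := ((hI'.inv_tendsto_atTop.const_mul 2).add
      (hIPL.const_mul (2 * ((k - 1 : ℕ) : ℝ) ^ 2))).const_sub 1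
    simpa using h
  exact tendsto_of_tendsto_of_tendsto_of_le_of_le hlim tendsto_const_nhds
    (fun m => ((R m).zeta_bounds hk (ℓ m)).2) (fun m => ((R m).zeta_bounds hk (ℓ m)).1)
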